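/- Let d ≥ 1, let S be a set, A a nonempty set, φ : S × A → ℝ^d a map with ‖φ(s,a)‖₂ ≤ 1 for all (s,a), and H > 0. For y ∈ ℝ^d and a symmetric positive semidefinite d×d real matrix Y, define V_{y,Y} : S → ℝ by V_{y,Y}(s) = min{ sup_{a∈A} ( ⟨y, φ(s,a)⟩ + √(φ(s,a)ᵀ Y φ(s,a)) ), H }. Then for any y¹, y² ∈ ℝ^d and any symmetric positive semidefinite d×d matrices Y¹, Y², one has sup_{s∈S} |V_{y¹,Y¹}(s) − V_{y²,Y²}(s)| ≤ ‖y¹ − y²‖₂ + √(‖Y¹ − Y²‖_F), where ‖·‖_F denotes the Frobenius norm. -/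

import Mathlib

open scoped RealInnerProductSpace

theorem Real.abs_sqrt_sub_sqrt_le {a b : ℝ} (ha : 0 ≤ a) (hb : 0 ≤ b) :
    |√a - √b| ≤ √|a - b| := by
  have key {x y : ℝ} (hy : 0 ≤ y) : √x ≤ √y + √|x - y| := by
    refine Real.sqrt_le_iff.2 ⟨by positivity, ?_⟩
    nlinarith [Real.sq_sqrt hy, Real.sq_sqrt (abs_nonneg (x - y)), le_abs_self (x - y),
      mul_nonneg (Real.sqrt_nonneg y) (Real.sqrt_nonneg |x - y|)]
  rw [abs_sub_le_iff]
  constructor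
  · linarith [key (x := a) hb]
  · rw [abs_sub_comm a b]
    linarith [key (x := b) ha]

theorem abs_ciSup_sub_ciSup_le {ι : Type*} [Nonempty ι] {f g : ι → ℝ} {C : ℝ}
    (hf : BddAbove (Set.range f)) (hg : BddAbove (Set.range g)) (h : ∀ i, |f i - g i| ≤ C) :
    |(⨆ i, f i) - ⨆ i, g i| ≤ C := by
  rw [abs_sub_le_iff, sub_le_iff_le_add, sub_le_iff_le_add]
  constructor
  · exact ciSup_le fun i => by linarith [le_ciSup hg i, (abs_sub_le_iff.1 (h i)).1]
  · exact ciSup_le fun i => by linarith [le_ciSup hf i, (abs_sub_le_iff.1 (h i)).2]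

theorem Matrix.norm_toEuclideanCLM_apply_le {n : Type*} [Fintype n] [DecidableEq n]
    (M : Matrix n n ℝ) (x : EuclideanSpace ℝ n) :
    ‖Matrix.toEuclideanCLM (𝕜 := ℝ) M x‖ ≤ √(∑ i, ∑ j, M i j ^ 2) * ‖x‖ := by
  rw [EuclideanSpace.norm_eq, EuclideanSpace.norm_eq, ← Real.sqrt_mul (by positivity)]
  refine Real.sqrt_le_sqrt ?_
  simp only [Real.norm_eq_abs, sq_abs]
  rw [Finset.sum_mul]
  refine Finset.sum_le_sum fun i _ => ?_
  rw [Matrix.ofLp_toEuclideanCLM]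
  exact Finset.sum_mul_sq_le_sq_mul_sq _ _ _

theorem Matrix.abs_inner_toEuclideanCLM_le {n : Type*} [Fintype n] [DecidableEq n]
    (M : Matrix n n ℝ) {x : EuclideanSpace ℝ n} (hx : ‖x‖ ≤ 1) :
    |⟪x, Matrix.toEuclideanCLM (𝕜 := ℝ) M x⟫| ≤ √(∑ i, ∑ j, M i j ^ 2) :=
  calc
    _ ≤ ‖x‖ * ‖Matrix.toEuclideanCLM (𝕜 := ℝ) M x‖ := abs_real_inner_le_norm _ _
    _ ≤ 1 * (√(∑ i, ∑ j, M i j ^ 2) * 1) := by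
      gcongr
      exact (M.norm_toEuclideanCLM_apply_le x).trans (by gcongr)
    _ = _ := by ring

theorem Matrix.PosSemidef.inner_toEuclideanCLM_nonneg {n : Type*} [Fintype n] [DecidableEq n]
    {M : Matrix n n ℝ} (hM : M.PosSemidef) (x : EuclideanSpace ℝ n) :
    0 ≤ ⟪x, Matrix.toEuclideanCLM (𝕜 := ℝ) M x⟫ := by
  have h := hM.dotProduct_mulVec_nonneg x.ofLp
  rwa [EuclideanSpace.inner_eq_star_dotProduct, Matrix.ofLp_toEuclideanCLM, dotProduct_comm]

theorem abs_inner_le_norm_of_norm_le_one {E : Type*} [NormedAddCommGroup E]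
    [InnerProductSpace ℝ E] (y : E) {x : E} (hx : ‖x‖ ≤ 1) : |⟪y, x⟫| ≤ ‖y‖ :=
  (abs_real_inner_le_norm _ _).trans (mul_le_of_le_one_right (norm_nonneg _) hx)

theorem bddAbove_range_inner_add_sqrt {n ι : Type*} [Fintype n] [DecidableEq n]
    {φ : ι → EuclideanSpace ℝ n} (hφ : ∀ a, ‖φ a‖ ≤ 1) (y : EuclideanSpace ℝ n)
    (M : Matrix n n ℝ) :
    BddAbove (Set.range fun a =>
      ⟪y, φ a⟫ + √⟪φ a, Matrix.toEuclideanCLM (𝕜 := ℝ) M (φ a)⟫) := by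
  refine ⟨‖y‖ + √√(∑ i, ∑ j, M i j ^ 2), ?_⟩
  rintro _ ⟨a, rfl⟩
  exact add_le_add ((le_abs_self _).trans (abs_inner_le_norm_of_norm_le_one y (hφ a)))
    (Real.sqrt_le_sqrt ((le_abs_self _).trans (M.abs_inner_toEuclideanCLM_le (hφ a))))

/-- Lipschitz-in-parameters estimate from the proof of Lemma B.3: the optimistic
value functions `V_{y,Y}(s) = min (sup_a (⟨y, φ(s,a)⟩ + √(φ(s,a)ᵀ Y φ(s,a)))) H`
satisfy `sup_s |V_{y¹,Y¹}(s) - V_{y²,Y²}(s)| ≤ ‖y¹ - y²‖₂ + √‖Y¹ - Y²‖_F`. -/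
theorem value_class_lipschitz_in_parameters
    (d : ℕ) (hd : 1 ≤ d) (S A : Type*) [Nonempty A]
    (φ : S → A → EuclideanSpace ℝ (Fin d)) (hφ : ∀ s a, ‖φ s a‖ ≤ 1)
    (H : ℝ) (hH : 0 < H)
    (y₁ y₂ : EuclideanSpace ℝ (Fin d)) (Y₁ Y₂ : Matrix (Fin d) (Fin d) ℝ)
    (hY₁s : Y₁.IsSymm) (hY₁ : Y₁.PosSemidef) (hY₂s : Y₂.IsSymm) (hY₂ : Y₂.PosSemidef) :
    ∀ s : S,
      |min (⨆ a : A, (⟪y₁, φ s a⟫ + Real.sqrt (⟪φ s a, (Matrix.toEuclideanCLM (𝕜 := ℝ) Y₁) (φ s a)⟫))) H -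
        min (⨆ a : A, (⟪y₂, φ s a⟫ + Real.sqrt (⟪φ s a, (Matrix.toEuclideanCLM (𝕜 := ℝ) Y₂) (φ s a)⟫))) H|
      ≤ ‖y₁ - y₂‖ + Real.sqrt (Real.sqrt (∑ i, ∑ j, (Y₁ i j - Y₂ i j) ^ 2)) := by
  intro s
  refine (abs_min_sub_min_le_max _ _ _ _).trans ?_
  rw [sub_self, abs_zero, max_eq_left (abs_nonneg _)]
  refine abs_ciSup_sub_ciSup_le (bddAbove_range_inner_add_sqrt (hφ s) y₁ Y₁)
    (bddAbove_range_inner_add_sqrt (hφ s) y₂ Y₂) fun a => ?_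
  rw [add_sub_add_comm, ← inner_sub_left]
  refine (abs_add_le _ _).trans
    (add_le_add (abs_inner_le_norm_of_norm_le_one _ (hφ s a)) ?_)
  refine (Real.abs_sqrt_sub_sqrt_le (hY₁.inner_toEuclideanCLM_nonneg _)
    (hY₂.inner_toEuclideanCLM_nonneg _)).trans (Real.sqrt_le_sqrt ?_)
  rw [← inner_sub_right, ← sub_apply, ← map_sub]
  exact (Y₁ - Y₂).abs_inner_toEuclideanCLM_le (hφ s a)
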